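/- arXiv:2002.06404 — 2 statements merged into one kernel-verified Lean document; each statement's English description precedes it below -/
import Mathlib

section
/- Let ≤ be a monomial order on R^r, let G = (p₁,…,p_k) ∈ R^{k×r} be a minimal ≤-Gröbner basis with μ_i = lm_≤(p_i), let ≺ be a Schreyer order for ≤ and (μ₁,…,μ_k), and let E ∈ R^{(k+n−1)×k} be elementary with pivot π, constants λ_i and α_j, such that λ_i = 0 whenever ε_i ≺ ε_π strictly. Assume ⟨EG⟩ ≠ ⟨G⟩. Let j₁ < … < j_ℓ be exactly those indices j ∈ {1,…,n} such that X_jμ_π does not belong to the submodule of R^r generated by {μ_i : i ≠ π}, and let Q ∈ R^{(k+ℓ−1)×k} be the submatrix of E whose rows are ε_i + λ_iε_π for i ≠ π and (X_{j_s} − α_{j_s})ε_π for s = 1,…,ℓ. Then QG is a minimal ≤-Gröbner basis of ⟨EG⟩; in particular ⟨QG⟩ = ⟨EG⟩. -/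
open MvPolynomial

/-! ### Monomials of the free module `R^r`, monomial orders, Gröbner bases

Here `R = K[X₁,…,Xₙ]` is `MvPolynomial (Fin n) K` and the free module `R^r`
is `Fin r → MvPolynomial (Fin n) K` (row vectors).  A monomial `ν eᵢ` of `R^r`
is encoded as a pair `(ν, i)`. -/

/-- A monomial of the free module `R^r`: an exponent vector in `n` variables
together with the index of the coordinate vector supporting it. -/
abbrev ModMon (n r : ℕ) := (Fin n →₀ ℕ) × Fin r

/-- Multiplication of a module monomial by a ring monomial. -/
noncomputable def smulMon {n r : ℕ} (ν : Fin n →₀ ℕ) (μ : ModMon n r) : ModMon n r :=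
  (ν + μ.1, μ.2)

/-- A monomial order on `R^r`: a total order on the monomials of `R^r` such that
`μ₁ ≤ μ₂` implies `μ₁ ≤ ν·μ₁ ≤ ν·μ₂` for every ring monomial `ν`. -/
structure ModMonomialOrder (n r : ℕ) where
  le : ModMon n r → ModMon n r → Prop
  le_refl : ∀ a, le a a
  le_trans : ∀ a b c, le a b → le b c → le a c
  le_antisymm : ∀ a b, le a b → le b a → a = b
  le_total : ∀ a b, le a b ∨ le b a
  compat : ∀ (ν : Fin n →₀ ℕ) (a b : ModMon n r),
    le a b → le a (smulMon ν a) ∧ le (smulMon ν a) (smulMon ν b)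

/-- The strict order associated with a monomial order. -/
def ModMonomialOrder.lt {n r : ℕ} (ord : ModMonomialOrder n r)
    (a b : ModMon n r) : Prop :=
  ord.le a b ∧ a ≠ b

/-- The module monomial `μ = ν eᵢ` as an element of `R^r`. -/
noncomputable def monElem (K : Type) [Field K] {n r : ℕ} (μ : ModMon n r) :
    Fin r → MvPolynomial (Fin n) K :=
  Pi.single μ.2 (monomial μ.1 (1 : K))

/-- `μ` is the `ord`-leading monomial of `p ∈ R^r`: it appears in `p` and every
monomial appearing in `p` is `≤ μ`. -/
def IsLM {K : Type} [Field K] {n r : ℕ} (ord : ModMonomialOrder n r)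
    (p : Fin r → MvPolynomial (Fin n) K) (μ : ModMon n r) : Prop :=
  coeff μ.1 (p μ.2) ≠ 0 ∧
  ∀ (m : Fin n →₀ ℕ) (i : Fin r), coeff m (p i) ≠ 0 → ord.le (m, i) μ

/-- Divisibility of module monomials: `μ ∣ μ'` iff `μ' = ν·μ` for a ring monomial `ν`. -/
def monDvd {n r : ℕ} (μ μ' : ModMon n r) : Prop :=
  ∃ ν : Fin n →₀ ℕ, smulMon ν μ = μ'

/-- The `ord`-leading module of a submodule `M ⊆ R^r`: the submodule generated by
the leading monomials of the nonzero elements of `M`. -/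
noncomputable def leadingSubmodule {K : Type} [Field K] {n r : ℕ}
    (ord : ModMonomialOrder n r)
    (M : Submodule (MvPolynomial (Fin n) K) (Fin r → MvPolynomial (Fin n) K)) :
    Submodule (MvPolynomial (Fin n) K) (Fin r → MvPolynomial (Fin n) K) :=
  Submodule.span (MvPolynomial (Fin n) K)
    {v | ∃ p ∈ M, ∃ μ : ModMon n r, IsLM ord p μ ∧ v = monElem K μ}

/-- `G` is a `ord`-Gröbner basis of `M`. -/
def IsGB {K : Type} [Field K] {n r : ℕ} {ι : Type} (ord : ModMonomialOrder n r)
    (M : Submodule (MvPolynomial (Fin n) K) (Fin r → MvPolynomial (Fin n) K))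
    (G : ι → Fin r → MvPolynomial (Fin n) K) : Prop :=
  (∀ i, G i ∈ M) ∧
  leadingSubmodule ord M =
    Submodule.span (MvPolynomial (Fin n) K)
      {v | ∃ (i : ι) (μ : ModMon n r), IsLM ord (G i) μ ∧ v = monElem K μ}

/-- `G` is a minimal `ord`-Gröbner basis of `M`: no leading monomial of an element
divides that of another element. -/
def IsMinimalGB {K : Type} [Field K] {n r : ℕ} {ι : Type} (ord : ModMonomialOrder n r)
    (M : Submodule (MvPolynomial (Fin n) K) (Fin r → MvPolynomial (Fin n) K))
    (G : ι → Fin r → MvPolynomial (Fin n) K) : Prop :=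
  IsGB ord M G ∧
  ∀ (i j : ι), i ≠ j → ∀ (μi μj : ModMon n r),
    IsLM ord (G i) μi → IsLM ord (G j) μj → ¬ monDvd μi μj

/-- `G` is the reduced `ord`-Gröbner basis of `M`: minimal, leading coefficients `1`,
and no term of `G i` is divisible by the leading monomial of `G j` for `j ≠ i`. -/
def IsReducedGB {K : Type} [Field K] {n r : ℕ} {ι : Type} (ord : ModMonomialOrder n r)
    (M : Submodule (MvPolynomial (Fin n) K) (Fin r → MvPolynomial (Fin n) K))
    (G : ι → Fin r → MvPolynomial (Fin n) K) : Prop :=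
  IsMinimalGB ord M G ∧
  (∀ (i : ι) (μi : ModMon n r), IsLM ord (G i) μi → coeff μi.1 (G i μi.2) = 1) ∧
  (∀ (i j : ι), i ≠ j → ∀ (μj : ModMon n r), IsLM ord (G j) μj →
    ∀ (m : Fin n →₀ ℕ) (l : Fin r), coeff m (G i l) ≠ 0 → ¬ monDvd μj (m, l))

/-- The rows of the elementary matrix `E ∈ R^{(k+n-1)×k}` with pivot `π`,
constants `lam i` (for `i ≠ π`) and `α j`: the rows `εᵢ + λᵢ ε_π` for `i ≠ π`
and `(Xⱼ - αⱼ) ε_π` for `1 ≤ j ≤ n`. -/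
noncomputable def elemRow {K : Type} [Field K] {n k : ℕ} (π : Fin k)
    (lam : Fin k → K) (α : Fin n → K) :
    ({i : Fin k // i ≠ π} ⊕ Fin n) → Fin k → MvPolynomial (Fin n) K :=
  Sum.elim
    (fun i => Pi.single i.1 (1 : MvPolynomial (Fin n) K)
      + lam i.1 • (Pi.single π 1 : Fin k → MvPolynomial (Fin n) K))
    (fun j => (X j - C (α j)) • (Pi.single π 1 : Fin k → MvPolynomial (Fin n) K))

/-- Rows of the matrix product `E·G` where `E` has rows in `R^k` indexed by `ι`
and `G ∈ R^{k×r}`. -/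
noncomputable def rowMul {K : Type} [Field K] {n k r : ℕ} {ι : Type}
    (E : ι → Fin k → MvPolynomial (Fin n) K)
    (G : Fin k → Fin r → MvPolynomial (Fin n) K) :
    ι → Fin r → MvPolynomial (Fin n) K :=
  fun a c => ∑ b, E a b * G b c

/-- `sord` is a Schreyer order for `ord` and the list of monomials `LM`. -/
def IsSchreyerOrder {n r k : ℕ} (ord : ModMonomialOrder n r)
    (LM : Fin k → ModMon n r) (sord : ModMonomialOrder n k) : Prop :=
  ∀ (ν₁ ν₂ : Fin n →₀ ℕ) (i j : Fin k),
    ord.lt (smulMon ν₁ (LM i)) (smulMon ν₂ (LM j)) → sord.le (ν₁, i) (ν₂, j)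

/-- Row vector times matrix, as a linear map `R^r → R^s`. -/
noncomputable def vecMulLin {K : Type} [Field K] {n r s : ℕ}
    (F : Fin r → Fin s → MvPolynomial (Fin n) K) :
    (Fin r → MvPolynomial (Fin n) K) →ₗ[MvPolynomial (Fin n) K]
      (Fin s → MvPolynomial (Fin n) K) :=
  Matrix.vecMulLinear (Matrix.of F)

/-- The syzygy module `Syz_N(F) = {p ∈ R^r : pF ∈ N}`. -/
noncomputable def Syz {K : Type} [Field K] {n r s : ℕ}
    (N : Submodule (MvPolynomial (Fin n) K) (Fin s → MvPolynomial (Fin n) K))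
    (F : Fin r → Fin s → MvPolynomial (Fin n) K) :
    Submodule (MvPolynomial (Fin n) K) (Fin r → MvPolynomial (Fin n) K) :=
  Submodule.comap (vecMulLin F) N

/-- `keepIdx K μ π j` holds iff `Xⱼ·μ_π` does not belong to the submodule of `R^r`
generated by the monomials `μ i`, `i ≠ π`. -/
def keepIdx (K : Type) [Field K] {n r k : ℕ} (μ : Fin k → ModMon n r) (π : Fin k)
    (j : Fin n) : Prop :=
  monElem K (smulMon (Finsupp.single j 1) (μ π)) ∉
    Submodule.span (MvPolynomial (Fin n) K)
      {v | ∃ i : Fin k, i ≠ π ∧ v = monElem K (μ i)}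

/-- The rows of the submatrix of the elementary matrix with pivot `π` keeping,
among the rows `(Xⱼ - αⱼ) ε_π`, only those with `P j`. -/
noncomputable def prunedRow {K : Type} [Field K] {n k : ℕ} (π : Fin k)
    (lam : Fin k → K) (α : Fin n → K) (P : Fin n → Prop) :
    ({i : Fin k // i ≠ π} ⊕ {j : Fin n // P j}) → Fin k → MvPolynomial (Fin n) K :=
  Sum.elim
    (fun i => Pi.single i.1 (1 : MvPolynomial (Fin n) K)
      + lam i.1 • (Pi.single π 1 : Fin k → MvPolynomial (Fin n) K))
    (fun j => (X j.1 - C (α j.1)) • (Pi.single π 1 : Fin k → MvPolynomial (Fin n) K))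

section ModuleMonomials

variable {K : Type} [Field K] {n r k : ℕ}

@[simp] lemma smulMon_zero (a : ModMon n r) : smulMon 0 a = a := by
  simp [smulMon]

lemma smulMon_smulMon (ν ρ : Fin n →₀ ℕ) (a : ModMon n r) :
    smulMon ν (smulMon ρ a) = smulMon (ν + ρ) a := by
  simp [smulMon, add_assoc]

lemma smulMon_left_injective (a : ModMon n r) :
    Function.Injective fun ν : Fin n →₀ ℕ => smulMon ν a := by
  intro ν ρ h
  simpa [smulMon] using h

lemma monElem_smulMon (ν : Fin n →₀ ℕ) (a : ModMon n r) :
    monElem K (smulMon ν a) = (monomial ν (1 : K)) • monElem K a := by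
  simp [monElem, smulMon, ← Pi.single_smul, monomial_mul]

lemma monElem_mem_of_monDvd
    {M : Submodule (MvPolynomial (Fin n) K) (Fin r → MvPolynomial (Fin n) K)}
    {a b : ModMon n r} (h : monDvd a b) (ha : monElem K a ∈ M) : monElem K b ∈ M := by
  obtain ⟨ν, rfl⟩ := h
  rw [monElem_smulMon]
  exact M.smul_mem _ ha

/-- A monomial appearing in an element of a monomial submodule is divisible by one of the
generating monomials. -/
lemma exists_monDvd_of_mem_span {S : Set (ModMon n r)} {p : Fin r → MvPolynomial (Fin n) K}
    (hp : p ∈ Submodule.span (MvPolynomial (Fin n) K) (monElem K '' S))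
    (m : Fin n →₀ ℕ) (i : Fin r) (hm : coeff m (p i) ≠ 0) : ∃ a ∈ S, monDvd a (m, i) := by
  induction hp using Submodule.span_induction generalizing m with
  | mem x hx =>
    obtain ⟨a, ha, rfl⟩ := hx
    refine ⟨a, ha, 0, ?_⟩
    obtain ⟨a, j⟩ := a
    by_cases hij : i = j
    · subst hij
      by_cases hma : a = m
      · simp [hma]
      · simp [monElem, coeff_monomial, hma] at hm
    · simp [monElem, hij] at hm
  | zero => simp at hm
  | add x y _ _ hx hy =>
    by_cases h : coeff m (x i) = 0
    · exact hy m (by simpa [h] using hm)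
    · exact hx m h
  | smul c x _ hx =>
    rw [Pi.smul_apply, smul_eq_mul, coeff_mul] at hm
    obtain ⟨⟨u, v⟩, huv, hne⟩ := Finset.exists_ne_zero_of_sum_ne_zero hm
    obtain ⟨a, ha, ν, hν⟩ := hx v (right_ne_zero_of_mul hne)
    refine ⟨a, ha, u + ν, ?_⟩
    rw [← smulMon_smulMon, hν, ← Finset.HasAntidiagonal.mem_antidiagonal.mp huv]
    rfl

lemma monElem_mem_span_iff {S : Set (ModMon n r)} {a : ModMon n r} :
    monElem K a ∈ Submodule.span (MvPolynomial (Fin n) K) (monElem K '' S) ↔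
      ∃ b ∈ S, monDvd b a := by
  constructor
  · intro h
    exact exists_monDvd_of_mem_span h a.1 a.2 (by simp [monElem])
  · rintro ⟨b, hb, hba⟩
    exact monElem_mem_of_monDvd hba (Submodule.subset_span ⟨b, hb, rfl⟩)

namespace ModMonomialOrder

variable (ord : ModMonomialOrder n r)

lemma le_smulMon (ν : Fin n →₀ ℕ) (a : ModMon n r) : ord.le a (smulMon ν a) :=
  (ord.compat ν a a (ord.le_refl a)).1

lemma lt_trans_le {a b c : ModMon n r} (hab : ord.lt a b) (hbc : ord.le b c) : ord.lt a c := by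
  refine ⟨ord.le_trans _ _ _ hab.1 hbc, ?_⟩
  rintro rfl
  exact hab.2 (ord.le_antisymm _ _ hab.1 hbc)

lemma le_trans_lt {a b c : ModMon n r} (hab : ord.le a b) (hbc : ord.lt b c) : ord.lt a c := by
  refine ⟨ord.le_trans _ _ _ hab hbc.1, ?_⟩
  rintro rfl
  exact hbc.2 (ord.le_antisymm _ _ hbc.1 hab)

/-- Monomial orders are well-founded, by Dickson's lemma. -/
lemma wellFounded_lt : WellFounded ord.lt := by
  have hwqo : WellQuasiOrdered fun a b : ModMon n r => a.1 ≤ b.1 ∧ a.2 = b.2 :=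
    WellQuasiOrdered.prod (wellQuasiOrdered_le (α := Fin n →₀ ℕ))
      (Finite.wellQuasiOrdered (α := Fin r) (· = ·))
  have : IsStrictOrder (ModMon n r) ord.lt :=
    { irrefl := fun a h => h.2 rfl
      trans := fun a b c hab hbc => ord.lt_trans_le hab hbc.1 }
  rw [RelEmbedding.wellFounded_iff_isEmpty]
  refine ⟨fun f => ?_⟩
  obtain ⟨p, q, hpq, h1, h2⟩ := hwqo f
  have hle : ord.le (f p) (f q) := by
    have h := ord.le_smulMon ((f q).1 - (f p).1) (f p)
    have heq : smulMon ((f q).1 - (f p).1) (f p) = f q :=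
      Prod.ext (tsub_add_cancel_of_le h1) h2
    rwa [heq] at h
  have hlt : ord.lt (f q) (f p) := f.map_rel_iff.mpr hpq
  exact hlt.2 (ord.le_antisymm _ _ hlt.1 hle)

end ModMonomialOrder

section LeadingMonomial

variable {ord : ModMonomialOrder n r} {p q : Fin r → MvPolynomial (Fin n) K} {a b : ModMon n r}

lemma IsLM.unique (ha : IsLM ord p a) (hb : IsLM ord p b) : a = b :=
  ord.le_antisymm _ _ (hb.2 a.1 a.2 ha.1) (ha.2 b.1 b.2 hb.1)

lemma exists_isLM (ord : ModMonomialOrder n r) (hp : p ≠ 0) : ∃ a, IsLM ord p a := by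
  let S : Set (ModMon n r) := {a | coeff a.1 (p a.2) ≠ 0}
  have hfin : S.Finite := by
    refine (Set.finite_iUnion fun i : Fin r =>
      ((p i).support.finite_toSet.image fun m => (m, i))).subset ?_
    rintro ⟨m, i⟩ h
    exact Set.mem_iUnion.mpr ⟨i, m, mem_support_iff.mpr h, rfl⟩
  have hne : S.Nonempty := by
    obtain ⟨i, hi⟩ := Function.ne_iff.mp hp
    obtain ⟨m, hm⟩ := ne_zero_iff.mp hi
    exact ⟨(m, i), hm⟩
  have := hfin.to_subtype
  have := hne.to_subtype
  have : IsTrans S fun a b => ord.le a b := ⟨fun _ _ _ => ord.le_trans _ _ _⟩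
  have hdir : Directed (fun a b : S => ord.le a b) id := fun a b =>
    (ord.le_total a b).elim (fun h => ⟨b, h, ord.le_refl _⟩) fun h => ⟨a, ord.le_refl _, h⟩
  obtain ⟨a, ha⟩ := hdir.finite_le id
  exact ⟨a, a.2, fun m i hm => ha ⟨(m, i), hm⟩⟩

lemma IsLM.add_of_lt (hp : IsLM ord p a)
    (hq : ∀ m i, coeff m (q i) ≠ 0 → ord.lt (m, i) a) : IsLM ord (p + q) a := by
  have hqa : coeff a.1 (q a.2) = 0 := by
    by_contra h
    exact (hq _ _ h).2 rfl
  refine ⟨by simpa [hqa] using hp.1, fun m i h => ?_⟩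
  by_cases hm : coeff m (p i) = 0
  · exact (hq m i (by simpa [hm] using h)).1
  · exact hp.2 m i hm

lemma IsLM.monomial_smul (hp : IsLM ord p a) (ν : Fin n →₀ ℕ) :
    IsLM ord (monomial ν (1 : K) • p) (smulMon ν a) := by
  refine ⟨by simpa [smulMon, coeff_monomial_mul] using hp.1, fun m i h => ?_⟩
  rw [Pi.smul_apply, smul_eq_mul, coeff_monomial_mul'] at h
  split_ifs at h with hν
  · have := (ord.compat ν _ _ (hp.2 (m - ν) i (by simpa using h))).2
    rwa [smulMon, add_tsub_cancel_of_le hν] at this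
  · exact absurd rfl h

lemma IsLM.X_sub_C_smul (hp : IsLM ord p a) (j : Fin n) (c : K) :
    IsLM ord ((X j - C c) • p) (smulMon (Finsupp.single j 1) a) := by
  have hlt : ord.lt a (smulMon (Finsupp.single j 1) a) := by
    refine ⟨ord.le_smulMon _ a, fun h => ?_⟩
    have h0 : (0 : Fin n →₀ ℕ) = Finsupp.single j 1 :=
      smulMon_left_injective a ((smulMon_zero a).trans h)
    simpa using DFunLike.congr_fun h0 j
  rw [sub_smul, sub_eq_add_neg]
  refine (hp.monomial_smul (Finsupp.single j 1)).add_of_lt fun m i h => ?_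
  refine ord.le_trans_lt (hp.2 m i ?_) hlt
  contrapose! h
  simp [h]

/-- Reduction: if every leading monomial in `D` of an element of `M` is the leading monomial of
an element of `M ⊓ P`, then `P` contains all elements of `M` with leading monomial in `D`. -/
lemma mem_of_isLM_of_reducible
    {M P : Submodule (MvPolynomial (Fin n) K) (Fin r → MvPolynomial (Fin n) K)}
    {D : ModMon n r → Prop} (hD : ∀ a b, ord.le a b → D b → D a)
    (hred : ∀ f ∈ M, ∀ a, IsLM ord f a → D a → ∃ g ∈ M ⊓ P, IsLM ord g a)
    {f : Fin r → MvPolynomial (Fin n) K} (hf : f ∈ M) (hfa : IsLM ord f a) (ha : D a) :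
    f ∈ P := by
  induction a using ord.wellFounded_lt.induction generalizing f with
  | _ a ih =>
    obtain ⟨g, ⟨hgM, hgP⟩, hga⟩ := hred f hf a hfa ha
    set c : K := coeff a.1 (f a.2) / coeff a.1 (g a.2) with hc
    have hcoeff : ∀ m i, coeff m ((f - (C c : MvPolynomial (Fin n) K) • g) i) = coeff m (f i) - c * coeff m (g i) := by
      intro m i
      simp
    suffices hsub : f - (C c : MvPolynomial (Fin n) K) • g ∈ P by
      simpa using P.add_mem hsub (P.smul_mem (C c) hgP)
    by_cases h0 : f - (C c : MvPolynomial (Fin n) K) • g = 0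
    · rw [h0]
      exact P.zero_mem
    obtain ⟨b, hb⟩ := exists_isLM ord h0
    have hle : ord.le b a := by
      have h := hb.1
      rw [hcoeff] at h
      by_cases hfb : coeff b.1 (f b.2) = 0
      · refine hga.2 _ _ fun hgb => h ?_
        simp [hfb, hgb]
      · exact hfa.2 _ _ hfb
    have hba : b ≠ a := by
      rintro rfl
      apply hb.1
      rw [hcoeff, hc, div_mul_cancel₀ _ hga.1, sub_self]
    exact ih b ⟨hle, hba⟩ (M.sub_mem hf (M.smul_mem _ hgM)) hb (hD _ _ hle ha)

/-- The leading monomials of a Gröbner basis divide those of the submodule. -/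
lemma IsGB.exists_monDvd {ι : Type} {G : ι → Fin r → MvPolynomial (Fin n) K}
    {M : Submodule (MvPolynomial (Fin n) K) (Fin r → MvPolynomial (Fin n) K)}
    (hG : IsGB ord M G) (hp : p ∈ M) (ha : IsLM ord p a) :
    ∃ i b, IsLM ord (G i) b ∧ monDvd b a := by
  have hmem : monElem K a ∈ leadingSubmodule ord M :=
    Submodule.subset_span ⟨p, hp, a, ha, rfl⟩
  have hset : {v | ∃ (i : ι) (b : ModMon n r), IsLM ord (G i) b ∧ v = monElem K b} =
      monElem K '' {b | ∃ i, IsLM ord (G i) b} := by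
    ext v
    constructor
    · rintro ⟨i, b, hb, rfl⟩
      exact ⟨b, ⟨i, hb⟩, rfl⟩
    · rintro ⟨b, ⟨i, hb⟩, rfl⟩
      exact ⟨i, b, hb, rfl⟩
  rw [hG.2, hset, monElem_mem_span_iff] at hmem
  obtain ⟨b, ⟨i, hi⟩, hb⟩ := hmem
  exact ⟨i, b, hi, hb⟩

/-- A family of elements of `M` whose leading monomials divide all leading monomials of `M` is a
Gröbner basis. -/
lemma isGB_of_exists_monDvd {ι : Type} {G : ι → Fin r → MvPolynomial (Fin n) K}
    {M : Submodule (MvPolynomial (Fin n) K) (Fin r → MvPolynomial (Fin n) K)}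
    (hG : ∀ i, G i ∈ M)
    (h : ∀ f ∈ M, ∀ a, IsLM ord f a → ∃ i b, IsLM ord (G i) b ∧ monDvd b a) :
    IsGB ord M G := by
  refine ⟨hG, le_antisymm (Submodule.span_le.mpr ?_) (Submodule.span_mono ?_)⟩
  · rintro _ ⟨f, hf, a, ha, rfl⟩
    obtain ⟨i, b, hb, hba⟩ := h f hf a ha
    exact monElem_mem_of_monDvd hba (Submodule.subset_span ⟨i, b, hb, rfl⟩)
  · rintro _ ⟨i, b, hb, rfl⟩
    exact ⟨G i, hG i, b, hb, rfl⟩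

/-- A Gröbner basis generates its submodule. -/
lemma IsGB.span_eq {ι : Type} {G : ι → Fin r → MvPolynomial (Fin n) K}
    {M : Submodule (MvPolynomial (Fin n) K) (Fin r → MvPolynomial (Fin n) K)}
    (hG : IsGB ord M G) :
    Submodule.span (MvPolynomial (Fin n) K) (Set.range G) = M := by
  refine le_antisymm (Submodule.span_le.mpr (Set.range_subset_iff.mpr hG.1)) fun f hf => ?_
  by_cases h0 : f = 0
  · rw [h0]
    exact Submodule.zero_mem _
  obtain ⟨a, ha⟩ := exists_isLM ord h0
  refine mem_of_isLM_of_reducible (D := fun _ => True) (fun _ _ _ _ => trivial) ?_ hf ha trivial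
  intro g hg b hb _
  obtain ⟨i, d, hd, ν, rfl⟩ := hG.exists_monDvd hg hb
  exact ⟨monomial ν 1 • G i, ⟨M.smul_mem _ (hG.1 i),
    Submodule.smul_mem _ _ (Submodule.subset_span ⟨i, rfl⟩)⟩, hd.monomial_smul ν⟩

end LeadingMonomial

lemma rowMul_elemRow_inl (G : Fin k → Fin r → MvPolynomial (Fin n) K) (π : Fin k)
    (lam : Fin k → K) (α : Fin n → K) (i : {i : Fin k // i ≠ π}) :
    rowMul (elemRow π lam α) G (Sum.inl i) =
      G i + (C (lam i) : MvPolynomial (Fin n) K) • G π := by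
  funext c
  simp [rowMul, elemRow, add_mul, Finset.sum_add_distrib, Pi.single_apply, smul_eq_C_mul,
    ite_mul, Finset.sum_ite_eq']

lemma rowMul_elemRow_inr (G : Fin k → Fin r → MvPolynomial (Fin n) K) (π : Fin k)
    (lam : Fin k → K) (α : Fin n → K) (j : Fin n) :
    rowMul (elemRow π lam α) G (Sum.inr j) = (X j - C (α j)) • G π := by
  funext c
  simp [rowMul, elemRow, Pi.single_apply]

lemma rowMul_prunedRow (G : Fin k → Fin r → MvPolynomial (Fin n) K) (π : Fin k)
    (lam : Fin k → K) (α : Fin n → K) (P : Fin n → Prop) :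
    rowMul (prunedRow π lam α P) G =
      rowMul (elemRow π lam α) G ∘ Sum.map id Subtype.val := by
  funext x
  cases x <;> rfl

lemma keepIdx_iff {μ : Fin k → ModMon n r} {π : Fin k} {j : Fin n} :
    keepIdx K μ π j ↔
      ∀ i, i ≠ π → ¬ monDvd (μ i) (smulMon (Finsupp.single j 1) (μ π)) := by
  have hset : {v | ∃ i : Fin k, i ≠ π ∧ v = monElem K (μ i)} =
      monElem K '' (μ '' {i | i ≠ π}) := by
    ext v
    constructor
    · rintro ⟨i, hi, rfl⟩
      exact ⟨_, ⟨i, hi, rfl⟩, rfl⟩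
    · rintro ⟨_, ⟨i, hi, rfl⟩, rfl⟩
      exact ⟨i, hi, rfl⟩
  rw [keepIdx, hset, monElem_mem_span_iff]
  simp

lemma IsSchreyerOrder.lt_of_lt {ord : ModMonomialOrder n r} {μ : Fin k → ModMon n r}
    {sord : ModMonomialOrder n k} (hs : IsSchreyerOrder ord μ sord) {i j : Fin k}
    (h : ord.lt (μ i) (μ j)) : sord.lt ((0 : Fin n →₀ ℕ), i) ((0 : Fin n →₀ ℕ), j) := by
  refine ⟨hs 0 0 i j (by simpa using h), fun hij => h.2 ?_⟩
  exact congrArg μ (Prod.ext_iff.mp hij).2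

end ModuleMonomials

/-- If `G` is a minimal `≤`-Gröbner basis and `⟨EG⟩ ≠ ⟨G⟩`,
then pruning from `E` the rows `(Xⱼ - αⱼ)ε_π` with `Xⱼμ_π ∈ ⟨μᵢ : i ≠ π⟩`
yields `Q` such that `Q·G` is a minimal `≤`-Gröbner basis of `⟨EG⟩`; in
particular `⟨QG⟩ = ⟨EG⟩`. -/
theorem statement8 {K : Type} [Field K] {n r k : ℕ}
    (ord : ModMonomialOrder n r)
    (G : Fin k → Fin r → MvPolynomial (Fin n) K)
    (hGB : IsMinimalGB ord
      (Submodule.span (MvPolynomial (Fin n) K) (Set.range G)) G)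
    (μ : Fin k → ModMon n r) (hμ : ∀ i, IsLM ord (G i) (μ i))
    (sord : ModMonomialOrder n k) (hs : IsSchreyerOrder ord μ sord)
    (π : Fin k) (lam : Fin k → K) (α : Fin n → K)
    (hlam : ∀ i : Fin k, i ≠ π →
      sord.lt ((0 : Fin n →₀ ℕ), i) ((0 : Fin n →₀ ℕ), π) → lam i = 0)
    (hne : Submodule.span (MvPolynomial (Fin n) K)
        (Set.range (rowMul (elemRow π lam α) G)) ≠
      Submodule.span (MvPolynomial (Fin n) K) (Set.range G)) :
    IsMinimalGB ord
      (Submodule.span (MvPolynomial (Fin n) K)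
        (Set.range (rowMul (elemRow π lam α) G)))
      (rowMul (prunedRow π lam α (keepIdx K μ π)) G) ∧
    Submodule.span (MvPolynomial (Fin n) K)
        (Set.range (rowMul (prunedRow π lam α (keepIdx K μ π)) G)) =
      Submodule.span (MvPolynomial (Fin n) K)
        (Set.range (rowMul (elemRow π lam α) G)) := by
  set M := Submodule.span (MvPolynomial (Fin n) K) (Set.range G)
  set N := Submodule.span (MvPolynomial (Fin n) K)
    (Set.range (rowMul (elemRow π lam α) G))
  have hGM : ∀ i, G i ∈ M := hGB.1.1
  have hndvd : ∀ i j, i ≠ j → ¬ monDvd (μ i) (μ j) := fun i j hij =>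
    hGB.2 i j hij _ _ (hμ i) (hμ j)
  have hlamlt : ∀ i, i ≠ π → ord.lt (μ i) (μ π) → lam i = 0 := fun i hi h =>
    hlam i hi (hs.lt_of_lt h)
  have hinl : ∀ i : {i : Fin k // i ≠ π}, G i + (C (lam i) : MvPolynomial (Fin n) K) • G π ∈ N := fun i =>
    Submodule.subset_span ⟨Sum.inl i, rowMul_elemRow_inl G π lam α i⟩
  have hinr : ∀ j, (X j - C (α j)) • G π ∈ N := fun j =>
    Submodule.subset_span ⟨Sum.inr j, rowMul_elemRow_inr G π lam α j⟩
  have hNM : N ≤ M := by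
    refine Submodule.span_le.mpr (Set.range_subset_iff.mpr ?_)
    rintro (i | j)
    · rw [rowMul_elemRow_inl]
      exact M.add_mem (hGM _) (M.smul_mem _ (hGM _))
    · rw [rowMul_elemRow_inr]
      exact M.smul_mem _ (hGM _)
  have hπN : G π ∉ N := by
    intro hπ
    refine hne (le_antisymm hNM (Submodule.span_le.mpr (Set.range_subset_iff.mpr fun i => ?_)))
    by_cases hi : i = π
    · exact hi ▸ hπ
    · simpa using N.sub_mem (hinl ⟨i, hi⟩) (N.smul_mem (C (lam i)) hπ)
  have hlow : ∀ f ∈ M, ∀ a, IsLM ord f a → ord.lt a (μ π) → f ∈ N := by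
    intro f hf a hfa ha
    refine mem_of_isLM_of_reducible (D := fun a => ord.lt a (μ π))
      (fun _ _ => ord.le_trans_lt) ?_ hf hfa ha
    intro g hg b hb hbπ
    obtain ⟨i, d, hd, ν, rfl⟩ := hGB.1.exists_monDvd hg hb
    obtain rfl := hd.unique (hμ i)
    have hlt := ord.le_trans_lt (ord.le_smulMon ν (μ i)) hbπ
    have hi : i ≠ π := by
      rintro rfl
      exact hlt.2 rfl
    have hiN : G i ∈ N := by
      simpa [hlamlt i hi hlt] using hinl ⟨i, hi⟩
    exact ⟨monomial ν 1 • G i, ⟨M.smul_mem _ (hGM i), N.smul_mem _ hiN⟩, hd.monomial_smul ν⟩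
  have hnotLM : ∀ f ∈ N, ¬ IsLM ord f (μ π) := by
    intro f hf hfπ
    set c : K := coeff (μ π).1 (G π (μ π).2) / coeff (μ π).1 (f (μ π).2) with hc
    have hcoeff : ∀ m i, coeff m ((G π - (C c : MvPolynomial (Fin n) K) • f) i) = coeff m (G π i) - c * coeff m (f i) := by
      intro m i
      simp
    suffices hsub : G π - (C c : MvPolynomial (Fin n) K) • f ∈ N from
      hπN (by simpa using N.add_mem hsub (N.smul_mem (C c) hf))
    by_cases h0 : G π - (C c : MvPolynomial (Fin n) K) • f = 0
    · rw [h0]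
      exact N.zero_mem
    obtain ⟨b, hb⟩ := exists_isLM ord h0
    refine hlow _ (M.sub_mem (hGM π) (M.smul_mem _ (hNM hf))) b hb ⟨?_, ?_⟩
    · have h := hb.1
      rw [hcoeff] at h
      by_cases hGb : coeff b.1 (G π b.2) = 0
      · refine hfπ.2 _ _ fun hfb => h ?_
        simp [hGb, hfb]
      · exact (hμ π).2 _ _ hGb
    · rintro rfl
      apply hb.1
      rw [hcoeff, hc, div_mul_cancel₀ _ hfπ.1, sub_self]
  have hlminl : ∀ i : {i : Fin k // i ≠ π},
      IsLM ord (rowMul (prunedRow π lam α (keepIdx K μ π)) G (Sum.inl i)) (μ i) := by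
    intro i
    rw [rowMul_prunedRow, Function.comp_apply, Sum.map_inl, id, rowMul_elemRow_inl]
    by_cases hi : lam i = 0
    · simpa [hi] using hμ i
    · have hne' : μ π ≠ μ i := fun h => hndvd π i i.2.symm ⟨0, by rw [smulMon_zero, h]⟩
      have hlt : ord.lt (μ π) (μ i) :=
        ⟨(ord.le_total _ _).resolve_right fun h => hi (hlamlt i i.2 ⟨h, hne'.symm⟩), hne'⟩
      refine (hμ i).add_of_lt fun m c h => ord.le_trans_lt ((hμ π).2 m c ?_) hlt
      contrapose! h
      simp [h]
  have hlminr : ∀ j : {j : Fin n // keepIdx K μ π j},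
      IsLM ord (rowMul (prunedRow π lam α (keepIdx K μ π)) G (Sum.inr j))
        (smulMon (Finsupp.single j.1 1) (μ π)) := by
    intro j
    rw [rowMul_prunedRow, Function.comp_apply, Sum.map_inr, rowMul_elemRow_inr]
    exact (hμ π).X_sub_C_smul j.1 (α j.1)
  have hGBQ : IsGB ord N (rowMul (prunedRow π lam α (keepIdx K μ π)) G) := by
    refine isGB_of_exists_monDvd (fun x => ?_) fun f hf a ha => ?_
    · rw [rowMul_prunedRow]
      exact Submodule.subset_span ⟨_, rfl⟩
    obtain ⟨i, d, hd, ν, rfl⟩ := hGB.1.exists_monDvd (hNM hf) ha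
    obtain rfl := hd.unique (hμ i)
    by_cases hi : i = π
    · subst hi
      have hν : ν ≠ 0 := by
        rintro rfl
        rw [smulMon_zero] at ha
        exact hnotLM f hf ha
      obtain ⟨j, hj⟩ := Finsupp.ne_iff.mp hν
      have hjν : ν - Finsupp.single j 1 + Finsupp.single j 1 = ν :=
        tsub_add_cancel_of_le (Finsupp.single_le_iff.mpr (Nat.one_le_iff_ne_zero.mpr hj))
      by_cases hkeep : keepIdx K μ i j
      · exact ⟨Sum.inr ⟨j, hkeep⟩, _, hlminr ⟨j, hkeep⟩, ν - Finsupp.single j 1, by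
          rw [smulMon_smulMon, hjν]⟩
      · rw [keepIdx_iff] at hkeep
        push Not at hkeep
        obtain ⟨l, hl, ρ, hρ⟩ := hkeep
        exact ⟨Sum.inl ⟨l, hl⟩, _, hlminl ⟨l, hl⟩, ν - Finsupp.single j 1 + ρ, by
          rw [← smulMon_smulMon, hρ, smulMon_smulMon, hjν]⟩
    · exact ⟨Sum.inl ⟨i, hi⟩, _, hlminl ⟨i, hi⟩, ν, rfl⟩
  refine ⟨⟨hGBQ, ?_⟩, hGBQ.span_eq⟩
  rintro (i | j) (i' | j') hij a b ha hb
  · obtain rfl := ha.unique (hlminl i)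
    obtain rfl := hb.unique (hlminl i')
    exact hndvd _ _ fun h => hij (congrArg Sum.inl (Subtype.ext h))
  · obtain rfl := ha.unique (hlminl i)
    obtain rfl := hb.unique (hlminr j')
    exact keepIdx_iff.mp j'.2 i i.2
  · obtain rfl := ha.unique (hlminr j)
    obtain rfl := hb.unique (hlminl i')
    rintro ⟨ν, hν⟩
    exact hndvd π i' i'.2.symm ⟨ν + Finsupp.single j.1 1, by rw [← smulMon_smulMon, hν]⟩
  · obtain rfl := ha.unique (hlminr j)
    obtain rfl := hb.unique (hlminr j')
    rintro ⟨ν, hν⟩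
    rw [smulMon_smulMon] at hν
    have h := DFunLike.congr_fun (smulMon_left_injective (μ π) hν) j.1
    have hjj : j'.1 ≠ j.1 := fun h => hij (congrArg Sum.inr (Subtype.ext h.symm))
    simp [hjj] at h
end

section
/- Let N ⊆ R^s be an R-submodule, F ∈ R^{r×s}, ≤ a monomial order on R^r, and G = (p₁,…,p_k) ∈ R^{k×r} a minimal ≤-Gröbner basis of Syz_N(F), with μ_i = lm_≤(p_i) and g_i = p_iF. Let λ : R^s → K be a K-linear functional such that ker(λ) ∩ N is an R-submodule of R^s, and assume (λ(g₁),…,λ(g_k)) ≠ (0,…,0). Let ≺ be a Schreyer order for ≤ and (μ₁,…,μ_k), let π be the index with λ(g_π) ≠ 0 such that ε_π is ≺-minimal among {ε_i : λ(g_i) ≠ 0}, and set λ_i = −λ(g_i)/λ(g_π) for i ≠ π and α_j = λ(X_j g_π)/λ(g_π) for 1 ≤ j ≤ n. Let E ∈ R^{(k+n−1)×k} be the elementary matrix with pivot π and these constants. Then E is a reduced ≺-Gröbner basis, and ⟨E⟩ = Syz_{ker(λ)∩N}(GF) = {q ∈ R^k : q·(GF) ∈ ker(λ) ∩ N}, where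 GF ∈ R^{k×s} is the matrix with rows g₁,…,g_k; in particular R^k/⟨E⟩ has K-dimension 1. -/
open MvPolynomial

theorem IsLM.unique_s9 {K : Type} [Field K] {n r : ℕ} {ord : ModMonomialOrder n r}
    {p : Fin r → MvPolynomial (Fin n) K} {μ μ' : ModMon n r}
    (h : IsLM ord p μ) (h' : IsLM ord p μ') : μ = μ' :=
  ord.le_antisymm _ _ (h'.2 _ _ h.1) (h.2 _ _ h'.1)

theorem ModMonomialOrder.zero_le {n r : ℕ} (ord : ModMonomialOrder n r) (m : Fin n →₀ ℕ)
    (i : Fin r) : ord.le (0, i) (m, i) := by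
  simpa [smulMon] using (ord.compat m (0, i) (0, i) (ord.le_refl _)).1

/-- The leading monomials of the rows of an elementary matrix. -/
noncomputable def elemRowLM {n k : ℕ} (π : Fin k) :
    ({i : Fin k // i ≠ π} ⊕ Fin n) → ModMon n k :=
  Sum.elim (fun i => (0, i.1)) (fun j => (Finsupp.single j 1, π))

section ElemRow

variable {K : Type} [Field K] {n k : ℕ} {π : Fin k} {c : Fin k → K} {α : Fin n → K}

theorem elemRow_inl_support {i : {i : Fin k // i ≠ π}} {m : Fin n →₀ ℕ} {l : Fin k}
    (h : coeff m (elemRow π c α (Sum.inl i) l) ≠ 0) :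
    m = 0 ∧ (l = i.1 ∨ (l = π ∧ c i.1 ≠ 0)) := by
  by_cases hli : l = i.1
  · subst hli
    refine ⟨?_, Or.inl rfl⟩
    by_contra hm
    exact h (by simp [elemRow, i.2, MvPolynomial.coeff_one, Ne.symm hm])
  · by_cases hlπ : l = π
    · subst hlπ
      refine ⟨?_, Or.inr ⟨rfl, ?_⟩⟩
      · by_contra hm
        exact h (by simp [elemRow, hli, MvPolynomial.coeff_one, Ne.symm hm])
      · intro hc
        exact h (by simp [elemRow, hli, hc])
    · exact absurd (by simp [elemRow, hli, hlπ]) h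

theorem elemRow_inr_support {j : Fin n} {m : Fin n →₀ ℕ} {l : Fin k}
    (h : coeff m (elemRow π c α (Sum.inr j) l) ≠ 0) :
    l = π ∧ (m = Finsupp.single j 1 ∨ m = 0) := by
  by_cases hlπ : l = π
  · subst hlπ
    refine ⟨rfl, ?_⟩
    by_contra! hm
    exact h (by simp [elemRow, MvPolynomial.coeff_X, MvPolynomial.coeff_C, Ne.symm hm.1,
      Ne.symm hm.2])
  · exact absurd (by simp [elemRow, hlπ]) h

theorem coeff_elemRowLM (a : {i : Fin k // i ≠ π} ⊕ Fin n) :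
    coeff (elemRowLM π a).1 (elemRow π c α a (elemRowLM π a).2) = 1 := by
  rcases a with i | j
  · simp [elemRow, elemRowLM, i.2]
  · have h0 : (0 : Fin n →₀ ℕ) ≠ Finsupp.single j 1 := by
      intro h
      simpa using DFunLike.congr_fun h j
    simp [elemRow, elemRowLM, MvPolynomial.coeff_C, h0]

theorem isLM_elemRow {ord : ModMonomialOrder n k}
    (hmin : ∀ i, i ≠ π → c i ≠ 0 → ord.le (0, π) (0, i))
    (a : {i : Fin k // i ≠ π} ⊕ Fin n) : IsLM ord (elemRow π c α a) (elemRowLM π a) := by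
  refine ⟨by rw [coeff_elemRowLM]; exact one_ne_zero, fun m l h => ?_⟩
  rcases a with i | j
  · obtain ⟨rfl, rfl | ⟨rfl, hc⟩⟩ := elemRow_inl_support h
    · exact ord.le_refl _
    · exact hmin _ i.2 hc
  · obtain ⟨rfl, rfl | rfl⟩ := elemRow_inr_support h
    · exact ord.le_refl _
    · exact ord.zero_le _ _

theorem not_elemRowLM_dvd {a b : {i : Fin k // i ≠ π} ⊕ Fin n} (hab : a ≠ b)
    {m : Fin n →₀ ℕ} {l : Fin k} (h : coeff m (elemRow π c α a l) ≠ 0) :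
    ¬ monDvd (elemRowLM π b) (m, l) := by
  rintro ⟨ν, hν⟩
  rcases b with i | j
  · obtain ⟨-, h2⟩ := Prod.mk.inj hν
    change i.1 = l at h2
    rcases a with i' | j'
    · obtain ⟨-, h3 | ⟨h3, -⟩⟩ := elemRow_inl_support h
      · exact hab (congrArg Sum.inl (Subtype.ext (h3.symm.trans h2.symm)))
      · exact i.2 (h2.trans h3)
    · exact i.2 (h2.trans (elemRow_inr_support h).1)
  · obtain ⟨h1, -⟩ := Prod.mk.inj hν
    change ν + Finsupp.single j 1 = m at h1
    have hj : m j ≠ 0 := by simp [← h1]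
    rcases a with i' | j'
    · exact hj (by simp [(elemRow_inl_support h).1])
    · obtain ⟨-, rfl | rfl⟩ := elemRow_inr_support h
      · have : j' ≠ j := fun e => hab (congrArg Sum.inr e)
        exact hj (by simp [this])
      · exact hj rfl

/-- Modulo the rows of an elementary matrix, every vector is a scalar multiple of the
pivot coordinate vector. -/
theorem exists_sub_C_smul_mem_span_elemRow (q : Fin k → MvPolynomial (Fin n) K) :
    ∃ a : K, q - (C a : MvPolynomial (Fin n) K) •
        (Pi.single π 1 : Fin k → MvPolynomial (Fin n) K) ∈
      Submodule.span (MvPolynomial (Fin n) K) (Set.range (elemRow π c α)) := by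
  have hrow : ∀ a, elemRow π c α a ∈ Submodule.span (MvPolynomial (Fin n) K)
      (Set.range (elemRow π c α)) := fun a => Submodule.subset_span ⟨a, rfl⟩
  generalize Submodule.span (MvPolynomial (Fin n) K) (Set.range (elemRow π c α)) = M at hrow ⊢
  obtain ⟨e, he⟩ : ∃ e : Fin k → MvPolynomial (Fin n) K, e = Pi.single π 1 := ⟨_, rfl⟩
  rw [← he]
  have hpoly : ∀ p : MvPolynomial (Fin n) K, p • e - (C (eval α p) : MvPolynomial (Fin n) K) • e ∈ M := by
    intro p
    induction p using MvPolynomial.induction_on with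
    | C a => simp
    | add p q hp hq =>
      rw [map_add, map_add, add_smul, add_smul, add_sub_add_comm]
      exact M.add_mem hp hq
    | mul_X p j hp =>
      convert M.add_mem (M.smul_mem p (hrow (Sum.inr j))) (M.smul_mem (C (α j)) hp) using 1
      simp only [elemRow, Sum.elim_inr, ← he, map_mul, eval_X]
      module
  have hcoord : ∀ i, ∃ a : K, (Pi.single i 1 : Fin k → MvPolynomial (Fin n) K) -
      (C a : MvPolynomial (Fin n) K) • e ∈ M := by
    intro i
    by_cases hi : i = π
    · exact ⟨1, by simp [hi, he]⟩
    · refine ⟨-c i, ?_⟩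
      convert hrow (Sum.inl ⟨i, hi⟩) using 1
      simp only [elemRow, Sum.elim_inl, ← he, map_neg, neg_smul, sub_neg_eq_add,
        MvPolynomial.C_eq_smul_one, smul_assoc, one_smul]
  choose a ha using hcoord
  refine ⟨eval α (∑ i, q i * C (a i)), ?_⟩
  have hq : q - (∑ i, q i * C (a i)) • e ∈ M := by
    have hsum := M.sum_mem (fun i (_ : i ∈ Finset.univ) => M.smul_mem (q i) (ha i))
    convert hsum using 1
    simp only [smul_sub, Finset.sum_sub_distrib, Finset.sum_smul, mul_smul]
    congr 1
    exact pi_eq_sum_univ' q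
  have h := M.add_mem hq (hpoly (∑ i, q i * C (a i)))
  rw [sub_add_sub_cancel] at h
  exact h

theorem isReducedGB_elemRow {ord : ModMonomialOrder n k}
    (hmin : ∀ i, i ≠ π → c i ≠ 0 → ord.le (0, π) (0, i))
    (hpivot : ∀ p ∈ Submodule.span (MvPolynomial (Fin n) K) (Set.range (elemRow π c α)),
      ¬ IsLM ord p (0, π)) :
    IsReducedGB ord
      (Submodule.span (MvPolynomial (Fin n) K) (Set.range (elemRow π c α)))
      (elemRow π c α) := by
  have hLM := isLM_elemRow (α := α) hmin
  have hrow : ∀ a, elemRow π c α a ∈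
      Submodule.span (MvPolynomial (Fin n) K) (Set.range (elemRow π c α)) :=
    fun a => Submodule.subset_span ⟨a, rfl⟩
  refine ⟨⟨⟨hrow, ?_⟩, ?_⟩, ?_, ?_⟩
  · apply le_antisymm
    · refine Submodule.span_le.2 ?_
      rintro _ ⟨p, hp, ⟨m, i⟩, hpm, rfl⟩
      have key : ∃ a, monDvd (elemRowLM π a) (m, i) := by
        by_cases hi : i = π
        · subst hi
          have hm : m ≠ 0 := by
            rintro rfl
            exact hpivot p hp hpm
          obtain ⟨j, hj⟩ := Finsupp.ne_iff.1 hm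
          refine ⟨Sum.inr j, m - Finsupp.single j 1, ?_⟩
          refine Prod.ext (tsub_add_cancel_of_le ?_) rfl
          rw [Finsupp.single_le_iff]
          exact Nat.one_le_iff_ne_zero.2 hj
        · exact ⟨Sum.inl ⟨i, hi⟩, m, Prod.ext (add_zero m) rfl⟩
      obtain ⟨a, ν, hν⟩ := key
      have hmon : monElem K (m, i) = monomial ν (1 : K) • monElem K (elemRowLM π a) := by
        rw [← hν, monElem, monElem, ← Pi.single_smul, smul_eq_mul, monomial_mul, one_mul]
        rfl
      rw [SetLike.mem_coe, hmon]
      exact Submodule.smul_mem _ _ (Submodule.subset_span ⟨a, _, hLM a, rfl⟩)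
    · refine Submodule.span_mono ?_
      rintro _ ⟨a, m, ha, rfl⟩
      exact ⟨_, hrow a, m, ha, rfl⟩
  · intro a b hab μa μb ha hb
    rw [ha.unique_s9 (hLM a), hb.unique_s9 (hLM b)]
    exact not_elemRowLM_dvd (Ne.symm hab) (hLM b).1
  · intro a m ha
    rw [ha.unique_s9 (hLM a)]
    exact coeff_elemRowLM a
  · intro a b hab m hb m' l h
    rw [hb.unique_s9 (hLM b)]
    exact not_elemRowLM_dvd hab h

end ElemRow

theorem vecMulLin_apply_eq_sum {K : Type} [Field K] {n r s : ℕ}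
    (F : Fin r → Fin s → MvPolynomial (Fin n) K) (q : Fin r → MvPolynomial (Fin n) K) :
    vecMulLin F q = ∑ i, q i • F i := by
  rw [vecMulLin, Matrix.vecMulLinear_apply, Matrix.vecMul_eq_sum]
  rfl

/-- Base case of the algorithm: with `G` a minimal Gröbner
basis of `Syz_N(F)`, `λ` a linear functional with `ker(λ) ∩ N` an `R`-module,
some `λ(gᵢ) ≠ 0`, pivot `π` chosen `≺`-minimal among indices with `λ(gᵢ) ≠ 0`,
and constants `λᵢ = -λ(gᵢ)/λ(g_π)`, `αⱼ = λ(Xⱼg_π)/λ(g_π)`, the elementary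
matrix `E` is a reduced `≺`-Gröbner basis, `⟨E⟩ = Syz_{ker(λ)∩N}(GF)`, and
`R^k/⟨E⟩` has `K`-dimension `1`. -/
theorem statement9 {K : Type} [Field K] {n r s k : ℕ}
    (N : Submodule (MvPolynomial (Fin n) K) (Fin s → MvPolynomial (Fin n) K))
    (F : Fin r → Fin s → MvPolynomial (Fin n) K)
    (ord : ModMonomialOrder n r)
    (G : Fin k → Fin r → MvPolynomial (Fin n) K)
    (hG : IsMinimalGB ord (Syz N F) G)
    (μ : Fin k → ModMon n r) (hμ : ∀ i, IsLM ord (G i) (μ i))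
    (lam : (Fin s → MvPolynomial (Fin n) K) →ₗ[K] K)
    (hker : ∀ (f : MvPolynomial (Fin n) K) (v : Fin s → MvPolynomial (Fin n) K),
      v ∈ N → lam v = 0 → lam (f • v) = 0)
    (g : Fin k → Fin s → MvPolynomial (Fin n) K)
    (hg : ∀ i, g i = vecMulLin F (G i))
    (sord : ModMonomialOrder n k) (hs : IsSchreyerOrder ord μ sord)
    (π : Fin k) (hπ : lam (g π) ≠ 0)
    (hπmin : ∀ i : Fin k, lam (g i) ≠ 0 →
      sord.le ((0 : Fin n →₀ ℕ), π) ((0 : Fin n →₀ ℕ), i))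
    (lamc : Fin k → K) (hlamc : ∀ i, i ≠ π → lamc i = - lam (g i) / lam (g π))
    (α : Fin n → K) (hα : ∀ j, α j = lam (fun c => X j * g π c) / lam (g π)) :
    IsReducedGB sord
      (Submodule.span (MvPolynomial (Fin n) K) (Set.range (elemRow π lamc α)))
      (elemRow π lamc α) ∧
    (∀ q : Fin k → MvPolynomial (Fin n) K,
      q ∈ Submodule.span (MvPolynomial (Fin n) K)
          (Set.range (elemRow π lamc α)) ↔
        (vecMulLin g q ∈ N ∧ lam (vecMulLin g q) = 0)) ∧
    Module.finrank K ((Fin k → MvPolynomial (Fin n) K) ⧸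
      (Submodule.span (MvPolynomial (Fin n) K)
        (Set.range (elemRow π lamc α))).restrictScalars K) = 1 := by
  have hgN : ∀ i, g i ∈ N := fun i => by
    rw [hg]
    exact hG.1.1 i
  have hvN : ∀ q, vecMulLin g q ∈ N := fun q => by
    rw [vecMulLin_apply_eq_sum]
    exact N.sum_mem fun i _ => N.smul_mem _ (hgN i)
  have hgπ : vecMulLin g (Pi.single π 1) = g π := by
    rw [vecMulLin, Matrix.vecMulLinear_apply, Matrix.single_one_vecMul]
    rfl
  have hgC : ∀ (a : K) (v : Fin s → MvPolynomial (Fin n) K),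
      lam ((C a : MvPolynomial (Fin n) K) • v) = a * lam v := fun a v => by
    rw [MvPolynomial.C_eq_smul_one, smul_assoc, one_smul, map_smul, smul_eq_mul]
  have hrow : ∀ a, lam (vecMulLin g (elemRow π lamc α a)) = 0 := by
    rintro (i | j)
    · have h : vecMulLin g (elemRow π lamc α (Sum.inl i)) =
          g i.1 + (C (lamc i.1) : MvPolynomial (Fin n) K) • g π := by
        rw [← hgπ, ← map_smul, MvPolynomial.C_eq_smul_one, smul_assoc, one_smul]
        simp only [elemRow, Sum.elim_inl, map_add]
        congr 1
        rw [vecMulLin, Matrix.vecMulLinear_apply, Matrix.single_one_vecMul]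
        rfl
      rw [h, map_add, hgC, hlamc _ i.2, div_mul_cancel₀ _ hπ, add_neg_cancel]
    · have h : vecMulLin g (elemRow π lamc α (Sum.inr j)) =
          (X j : MvPolynomial (Fin n) K) • g π - (C (α j) : MvPolynomial (Fin n) K) • g π := by
        rw [elemRow, Sum.elim_inr, map_smul, hgπ, sub_smul]
      rw [h, map_sub, hgC, hα, div_mul_cancel₀ _ hπ, sub_eq_zero]
      rfl
  have hspan : ∀ q ∈ Submodule.span (MvPolynomial (Fin n) K)
      (Set.range (elemRow π lamc α)), lam (vecMulLin g q) = 0 := by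
    intro q hq
    induction hq using Submodule.span_induction with
    | mem x hx =>
      obtain ⟨a, rfl⟩ := hx
      exact hrow a
    | zero => simp
    | add x y _ _ hx hy => simp [hx, hy]
    | smul f x _ hx =>
      rw [map_smul]
      exact hker f _ (hvN x) hx
  have hmem : ∀ q, lam (vecMulLin g q) = 0 → q ∈ Submodule.span (MvPolynomial (Fin n) K)
      (Set.range (elemRow π lamc α)) := by
    intro q hq
    obtain ⟨a, ha⟩ := exists_sub_C_smul_mem_span_elemRow (π := π) (c := lamc) (α := α) q
    have h := hspan _ ha
    rw [map_sub, map_sub, hq, map_smul, hgπ, hgC, zero_sub, neg_eq_zero] at h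
    have ha0 : a = 0 := (mul_eq_zero.1 h).resolve_right hπ
    simpa [ha0] using ha
  refine ⟨isReducedGB_elemRow ?_ ?_, ?_, ?_⟩
  · intro i hi hc
    refine hπmin i fun h0 => hc ?_
    rw [hlamc i hi, h0, neg_zero, zero_div]
  · intro p hp hLM
    have hpi : ∀ i, i ≠ π → lam (p i • g i) = 0 := by
      intro i hi
      by_cases h0 : lam (g i) = 0
      · exact hker _ _ (hgN i) h0
      · have hp0 : p i = 0 := by
          ext m
          by_contra hm
          have hle := sord.le_trans _ _ _ (sord.zero_le m i) (hLM.2 m i hm)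
          exact hi (Prod.mk.inj (sord.le_antisymm _ _ hle (hπmin i h0))).2
        simp [hp0]
    have hpπ : p π = C (coeff 0 (p π)) := by
      ext m
      rw [MvPolynomial.coeff_C]
      split_ifs with h
      · rw [h]
      · by_contra hm
        exact h (Prod.mk.inj (sord.le_antisymm _ _ (sord.zero_le m π) (hLM.2 m π hm))).1
    have h := hspan p hp
    rw [vecMulLin_apply_eq_sum, map_sum, Finset.sum_eq_single π (fun i _ hi => hpi i hi)
      (fun h => absurd (Finset.mem_univ π) h), hpπ, hgC] at h
    exact mul_ne_zero hLM.1 hπ h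
  · exact fun q => ⟨fun hq => ⟨hvN q, hspan q hq⟩, fun h => hmem q h.2⟩
  · let L : (Fin k → MvPolynomial (Fin n) K) →ₗ[K] K :=
      lam ∘ₗ (vecMulLin g).restrictScalars K
    have hL : (Submodule.span (MvPolynomial (Fin n) K)
        (Set.range (elemRow π lamc α))).restrictScalars K = LinearMap.ker L :=
      Submodule.ext fun q => ⟨hspan q, hmem q⟩
    have hsurj : Function.Surjective L := by
      refine LinearMap.surjective fun h0 => hπ ?_
      rw [← hgπ]
      exact LinearMap.congr_fun h0 (Pi.single π 1)
    rw [hL, (L.quotKerEquivOfSurjective hsurj).finrank_eq, Module.finrank_self]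
end
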